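/- Let $\Omega\subseteq\mathbb{R}^2$ be open, $u\in C(\Omega)$, $g\in C(\Omega)$ bounded, and suppose $u$ is a distributional solution of $\partial_t u-\partial_x(u^2/2)=g$ on $\Omega$. Let $\gamma(t)=(t,\xi(t))$, $t\in[0,T]$, be a $C^1$ characteristic with $\dot\xi=-u\circ\gamma$, and assume for some $\epsilon_0>0$ the right tube $\{(t,x):t\in[0,T],\ \xi(t)\le x\le\xi(t)+\epsilon_0\}\subseteq\Omega$. Then for all $0<\epsilon\le\epsilon_0$, $\int_{\xi(T)}^{\xi(T)+\epsilon}u(T,x)\,dx-\int_{\xi(0)}^{\xi(0)+\epsilon}u(0,x)\,dx-\int_0^T\!\!\int_{\xi(t)}^{\xi(t)+\epsilon}g(t,x)\,dx\,dt=\tfrac12\int_0^T\big(u(t,\xi(t)+\epsilon)-u(t,\xi(t))\big)^2\,dt\ \ge\ -\epsilon\,\|g\|_{L^\infty(\Omega)}T+\int_{\xi(T)}^{\xi(T)+\epsilon}u(T,x)\,dx-\int_{\xi(0)}^{\xi(0)+\epsilon}u(0,x)\,dx \text{ implies } u(T,\xi(T))-u(0,\xi(0))\ge-\|g\|_{L^\infty(\Omega)}T$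 after dividing by $\epsilon$ and letting $\epsilon\to0$. -/

import Mathlib

open MeasureTheory

lemma dfm_ext {K : Set (ℝ × ℝ)} (hK : IsClosed K) {u : ℝ × ℝ → ℝ} (hu : ContinuousOn u K) :
    ∃ U : ℝ × ℝ → ℝ, Continuous U ∧ ∀ p ∈ K, U p = u p := by
  obtain ⟨U, hU⟩ := ContinuousMap.exists_restrict_eq hK ⟨K.domRestrict u, hu.domRestrict⟩
  refine ⟨U, U.continuous, fun p hp => ?_⟩
  have := congrArg (fun f => f ⟨p, hp⟩) hU
  exact this

lemma dfm_unif {K : Set (ℝ × ℝ)} (hK : IsCompact K) {U : ℝ × ℝ → ℝ} (hU : Continuous U)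
    {η : ℝ} (hη : 0 < η) :
    ∃ δ > 0, ∀ p ∈ K, ∀ q, dist q p < δ → dist (U q) (U p) ≤ η := by
  have := hK.uniformContinuousAt_of_continuousAt U (fun a _ => hU.continuousAt)
    (Metric.dist_mem_uniformity hη)
  obtain ⟨δ, hδ, h⟩ := Metric.mem_uniformity_dist.1 this
  refine ⟨δ, hδ, fun p hp q hq => ?_⟩
  have := h (a := p) (b := q) (by rwa [dist_comm]) hp
  rw [dist_comm]
  exact le_of_lt this

lemma dfm_fderiv_conv {ρ U : ℝ × ℝ → ℝ} (hρ : ContDiff ℝ (⊤ : ℕ∞) ρ) (hc : HasCompactSupport ρ)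
    (hU : Continuous U) (p v : ℝ × ℝ) :
    fderiv ℝ (convolution ρ U (ContinuousLinearMap.lsmul ℝ ℝ) volume) p v =
      ∫ q, fderiv ℝ ρ (p - q) v * U q := by
  have hρ1 : ContDiff ℝ 1 ρ := hρ.of_le (by exact_mod_cast le_top)
  have h := hc.hasFDerivAt_convolution_left (ContinuousLinearMap.lsmul ℝ ℝ) hρ1
    (hU.locallyIntegrable (μ := volume)) p
  rw [h.fderiv]
  have hex := (hc.fderiv ℝ).convolutionExists_left
    ((ContinuousLinearMap.lsmul ℝ ℝ).precompL (ℝ × ℝ))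
    (hρ1.continuous_fderiv one_ne_zero)
    (hU.locallyIntegrable (μ := volume)) p
  rw [convolution_def, ContinuousLinearMap.integral_apply hex]
  rw [← integral_sub_left_eq_self _ volume p]
  simp

lemma dfm_int {ρ U : ℝ × ℝ → ℝ} (hρ : ContDiff ℝ (⊤ : ℕ∞) ρ) (hc : HasCompactSupport ρ)
    (hU : Continuous U) (p v : ℝ × ℝ) :
    Integrable (fun q => fderiv ℝ ρ (p - q) v * U q) := by
  have hρ1 : ContDiff ℝ 1 ρ := hρ.of_le (by exact_mod_cast le_top)
  have hcont := hρ1.continuous_fderiv one_ne_zero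
  apply Continuous.integrable_of_hasCompactSupport
  · fun_prop
  · apply HasCompactSupport.mul_right
    have h1 : HasCompactSupport (fun q => fderiv ℝ ρ q v) := by
      refine (hc.fderiv ℝ).mono ?_
      intro x hx
      simp only [Function.mem_support] at hx ⊢
      intro h0; apply hx; rw [h0]; rfl
    exact h1.comp_homeomorph (Homeomorph.subLeft p)

lemma dfm_mollify {Ω K : Set (ℝ × ℝ)} {u g U G : ℝ × ℝ → ℝ}
    (hdistr : ∀ φ : ℝ × ℝ → ℝ, ContDiff ℝ (⊤ : ℕ∞) φ → HasCompactSupport φ → tsupport φ ⊆ Ω →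
      ∫ p in Ω, (-(u p) * fderiv ℝ φ p (1, 0) + (u p) ^ 2 / 2 * fderiv ℝ φ p (0, 1)) =
        ∫ p in Ω, g p * φ p)
    (hK : IsCompact K) {δ₀ : ℝ} (hδ₀ : 0 < δ₀) (hKΩ : Metric.cthickening δ₀ K ⊆ Ω)
    (hU : Continuous U) (hG : Continuous G)
    (hUu : ∀ p ∈ Metric.cthickening δ₀ K, U p = u p)
    (hGg : ∀ p ∈ Metric.cthickening δ₀ K, G p = g p) {η : ℝ} (hη : 0 < η) :
    ∃ a w h : ℝ × ℝ → ℝ, ContDiff ℝ 1 a ∧ ContDiff ℝ 1 w ∧ Continuous h ∧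
      ∀ p ∈ K, fderiv ℝ a p (1, 0) = fderiv ℝ w p (0, 1) + h p ∧ |a p - U p| ≤ η ∧
        |w p - U p ^ 2 / 2| ≤ η ∧ |h p - G p| ≤ η := by
  have hW : Continuous (fun p => U p ^ 2 / 2) := by fun_prop
  obtain ⟨δ1, hδ1, h1⟩ := dfm_unif hK hU hη
  obtain ⟨δ2, hδ2, h2⟩ := dfm_unif hK hW hη
  obtain ⟨δ3, hδ3, h3⟩ := dfm_unif hK hG hη
  set δ := min δ₀ (min δ1 (min δ2 δ3)) with hδ
  have hδpos : 0 < δ := by simp [*]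
  have hl0 : δ ≤ δ₀ := min_le_left _ _
  have hl1 : δ ≤ δ1 := (min_le_right _ _).trans (min_le_left _ _)
  have hl2 : δ ≤ δ2 := (min_le_right _ _).trans ((min_le_right _ _).trans (min_le_left _ _))
  have hl3 : δ ≤ δ3 := (min_le_right _ _).trans ((min_le_right _ _).trans (min_le_right _ _))
  let φ : ContDiffBump (0 : ℝ × ℝ) := ⟨δ / 2, δ, by positivity, by linarith⟩
  set ρ : ℝ × ℝ → ℝ := φ.normed volume with hρdef
  have hρ : ContDiff ℝ (⊤ : ℕ∞) ρ := φ.contDiff_normed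
  have hρ1 : ContDiff ℝ (1 : ℕ∞) ρ := φ.contDiff_normed
  have hc : HasCompactSupport ρ := φ.hasCompactSupport_normed
  refine ⟨convolution ρ U (ContinuousLinearMap.lsmul ℝ ℝ) volume,
    convolution ρ (fun p => U p ^ 2 / 2) (ContinuousLinearMap.lsmul ℝ ℝ) volume,
    convolution ρ G (ContinuousLinearMap.lsmul ℝ ℝ) volume,
    hc.contDiff_convolution_left _ hρ1 hU.locallyIntegrable,
    hc.contDiff_convolution_left _ hρ1 hW.locallyIntegrable,
    (hc.contDiff_convolution_left _ hρ1 hG.locallyIntegrable).continuous, fun p hp => ⟨?_, ?_, ?_, ?_⟩⟩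
  · rw [dfm_fderiv_conv hρ hc hU, dfm_fderiv_conv hρ hc hW, convolution_def,
      ← integral_sub_left_eq_self (fun t => (ContinuousLinearMap.lsmul ℝ ℝ) (ρ t) (G (p - t))) volume p]
    simp only [sub_sub_cancel, ContinuousLinearMap.lsmul_apply, smul_eq_mul]
    have hψ : ContDiff ℝ (⊤ : ℕ∞) (fun q => ρ (p - q)) := hρ.comp (contDiff_const.sub contDiff_id)
    have hψc : HasCompactSupport (fun q => ρ (p - q)) := hc.comp_homeomorph (Homeomorph.subLeft p)
    have hψs : tsupport (fun q => ρ (p - q)) ⊆ Metric.cthickening δ₀ K := by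
      refine closure_minimal (fun q hq => ?_) Metric.isClosed_cthickening
      have : p - q ∈ Function.support ρ := hq
      rw [hρdef, φ.support_normed_eq] at this
      have h' : dist q p < δ := by
        rw [dist_comm, dist_eq_norm]; simpa using this
      exact Metric.mem_cthickening_of_dist_le q p _ _ hp (h'.le.trans hl0)
    have hψd : ∀ q v, fderiv ℝ (fun q => ρ (p - q)) q v = - fderiv ℝ ρ (p - q) v := by
      intro q v
      have hd : HasFDerivAt ρ (fderiv ℝ ρ (p - q)) (p - q) :=
        (hρ1.differentiable (by simp)).differentiableAt.hasFDerivAt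
      have := hd.comp q ((hasFDerivAt_const p q).sub (hasFDerivAt_id q))
      have h2 := this.fderiv
      have h3 : (ρ ∘ ((fun _ : ℝ × ℝ => p) - id)) = fun q => ρ (p - q) := by ext; rfl
      simp only [Function.comp_def] at h2
      erw [h2]
      simp
    have key := hdistr _ hψ hψc (hψs.trans hKΩ)
    have hzero : ∀ q, q ∉ Metric.cthickening δ₀ K → ρ (p - q) = 0 ∧
        ∀ v, fderiv ℝ ρ (p - q) v = 0 := by
      intro q hq
      have hq' : q ∉ tsupport (fun q => ρ (p - q)) := fun h => hq (hψs h)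
      refine ⟨image_eq_zero_of_notMem_tsupport (f := fun q => ρ (p - q)) hq', fun v => ?_⟩
      have := hψd q v
      rw [fderiv_of_notMem_tsupport ℝ hq'] at this
      simpa using this.symm
    rw [setIntegral_eq_integral_of_forall_compl_eq_zero,
      setIntegral_eq_integral_of_forall_compl_eq_zero] at key
    rotate_left
    · intro q hq
      rw [(hzero q (fun h => hq (hKΩ h))).1, mul_zero]
    · intro q hq
      simp only [hψd]
      rw [(hzero q (fun h => hq (hKΩ h))).2, (hzero q (fun h => hq (hKΩ h))).2]; simp
    have e1 : (∫ q, g q * ρ (p - q)) = ∫ q, ρ (p - q) * G q := by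
      congr 1; ext q
      by_cases hq : q ∈ Metric.cthickening δ₀ K
      · rw [hGg q hq, mul_comm]
      · rw [(hzero q hq).1]; simp
    have e2 : (∫ q, (-(u q) * fderiv ℝ (fun q => ρ (p - q)) q (1, 0) +
        (u q) ^ 2 / 2 * fderiv ℝ (fun q => ρ (p - q)) q (0, 1))) =
        ∫ q, (fderiv ℝ ρ (p - q) (1, 0) * U q - fderiv ℝ ρ (p - q) (0, 1) * (U q ^ 2 / 2)) := by
      congr 1; ext q
      rw [hψd, hψd]
      by_cases hq : q ∈ Metric.cthickening δ₀ K
      · rw [hUu q hq]; ring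
      · rw [(hzero q hq).2, (hzero q hq).2]; simp
    rw [e1, e2, integral_sub (dfm_int hρ hc hU p _) (dfm_int hρ hc hW p _)] at key
    linarith
  · have := φ.dist_normed_convolution_le (μ := volume) (x₀ := p) (ε := η) hU.aestronglyMeasurable
      (fun q hq => h1 p hp q (lt_of_lt_of_le hq hl1))
    rwa [Real.dist_eq] at this
  · have := φ.dist_normed_convolution_le (μ := volume) (x₀ := p) (ε := η) hW.aestronglyMeasurable
      (fun q hq => h2 p hp q (lt_of_lt_of_le hq hl2))
    rwa [Real.dist_eq] at this
  · have := φ.dist_normed_convolution_le (μ := volume) (x₀ := p) (ε := η) hG.aestronglyMeasurable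
      (fun q hq => h3 p hp q (lt_of_lt_of_le hq hl3))
    rwa [Real.dist_eq] at this

lemma dfm_classical {a w h V : ℝ × ℝ → ℝ} (ha : ContDiff ℝ 1 a) (hw : ContDiff ℝ 1 w)
    (hh : Continuous h) (hV : Continuous V) {X : ℝ → ℝ} (hX : Continuous X) {T ε : ℝ} (hT : 0 ≤ T)
    (hε : 0 ≤ ε)
    (hd : ∀ t ∈ Set.Ioo 0 T, HasDerivAt X (-(V (t, X t))) t)
    (heq : ∀ t ∈ Set.Icc 0 T, ∀ y ∈ Set.Icc 0 ε,
      fderiv ℝ a (t, X t + y) (1, 0) = fderiv ℝ w (t, X t + y) (0, 1) + h (t, X t + y)) :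
    (∫ y in (0:ℝ)..ε, a (T, X T + y)) - (∫ y in (0:ℝ)..ε, a (0, X 0 + y)) =
      ∫ t in (0:ℝ)..T, (w (t, X t + ε) - w (t, X t) + (∫ y in (0:ℝ)..ε, h (t, X t + y))
        - V (t, X t) * (a (t, X t + ε) - a (t, X t))) := by
  have hac := ha.continuous
  have hwc := hw.continuous
  have hda := ha.continuous_fderiv one_ne_zero
  have hdw := hw.continuous_fderiv one_ne_zero
  have hfa : ∀ p, HasFDerivAt a (fderiv ℝ a p) p := fun p =>
    (ha.differentiable one_ne_zero).differentiableAt.hasFDerivAt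
  have hfw : ∀ p, HasFDerivAt w (fderiv ℝ w p) p := fun p =>
    (hw.differentiable one_ne_zero).differentiableAt.hasFDerivAt
  let D : ℝ → ℝ → ℝ := fun y t => fderiv ℝ a (t, X t + y) (1, -(V (t, X t)))
  have hD : Continuous D.uncurry := by
    simp only [D, Function.uncurry_def]
    fun_prop
  have hDt : ∀ y, ∫ t in (0:ℝ)..T, D y t = a (T, X T + y) - a (0, X 0 + y) := by
    intro y
    refine intervalIntegral.integral_eq_sub_of_hasDerivAt_of_le (f := fun t => a (t, X t + y)) hT
      (by fun_prop) (fun t ht => ?_) (Continuous.intervalIntegrable (by fun_prop) _ _)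
    have h1 : HasDerivAt (fun t => (t, X t + y)) ((1 : ℝ), -(V (t, X t))) t :=
      (hasDerivAt_id t).prodMk ((hd t ht).add_const y)
    exact (hfa (t, X t + y)).comp_hasDerivAt t h1
  have hx : ∀ (f : ℝ × ℝ → ℝ), ContDiff ℝ 1 f → ∀ t : ℝ,
      ∫ y in (0:ℝ)..ε, fderiv ℝ f (t, X t + y) (0, 1) = f (t, X t + ε) - f (t, X t) := by
    intro f hf t
    have hfc := hf.continuous
    have hdf := hf.continuous_fderiv one_ne_zero
    have := intervalIntegral.integral_eq_sub_of_hasDerivAt_of_le (f := fun y => f (t, X t + y))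
      (f' := fun y => fderiv ℝ f (t, X t + y) (0, 1)) hε
      (by fun_prop) (fun y hy => ?_) (Continuous.intervalIntegrable (by fun_prop) _ _)
    · simpa using this
    have h1 : HasDerivAt (fun y => (t, X t + y)) ((0 : ℝ), (1:ℝ)) y :=
      (hasDerivAt_const y t).prodMk ((hasDerivAt_id y).const_add (X t))
    exact ((hf.differentiable one_ne_zero).differentiableAt.hasFDerivAt).comp_hasDerivAt y h1
  rw [← intervalIntegral.integral_sub (Continuous.intervalIntegrable (by fun_prop) _ _)
    (Continuous.intervalIntegrable (by fun_prop) _ _)]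
  simp_rw [← hDt]
  rw [intervalIntegral_intervalIntegral_swap]
  · apply intervalIntegral.integral_congr
    intro t ht
    rw [Set.uIcc_of_le hT] at ht
    have h1 : ∫ y in (0:ℝ)..ε, D y t = ∫ y in (0:ℝ)..ε, (fderiv ℝ w (t, X t + y) (0, 1) +
        h (t, X t + y) - V (t, X t) * fderiv ℝ a (t, X t + y) (0, 1)) := by
      apply intervalIntegral.integral_congr
      intro y hy
      rw [Set.uIcc_of_le hε] at hy
      simp only [D]
      rw [← heq t ht y hy]
      have : ((1 : ℝ), -(V (t, X t))) = (1, 0) + (-(V (t, X t))) • ((0:ℝ), (1:ℝ)) := by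
        simp
      rw [this, map_add, map_smul]
      simp; ring
    simp only []
    rw [h1, intervalIntegral.integral_sub (Continuous.intervalIntegrable (by fun_prop) _ _)
      (Continuous.intervalIntegrable (by fun_prop) _ _),
      intervalIntegral.integral_add (Continuous.intervalIntegrable (by fun_prop) _ _)
      (Continuous.intervalIntegrable (by fun_prop) _ _), intervalIntegral.integral_const_mul,
      hx w hw, hx a ha]
  · refine (hD.continuousOn.integrableOn_compact (isCompact_uIcc.prod isCompact_uIcc)).mono_set
      (Set.prod_mono Set.uIoc_subset_uIcc Set.uIoc_subset_uIcc)

lemma dfm_core {U G : ℝ × ℝ → ℝ} (hU : Continuous U) (hG : Continuous G)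
    {X : ℝ → ℝ} (hX : Continuous X) {T ε : ℝ} (hT : 0 ≤ T) (hε : 0 ≤ ε)
    (hd : ∀ t ∈ Set.Ioo 0 T, HasDerivAt X (-(U (t, X t))) t)
    (happ : ∀ η : ℝ, 0 < η → ∃ a w h : ℝ × ℝ → ℝ, ContDiff ℝ 1 a ∧ ContDiff ℝ 1 w ∧
      Continuous h ∧ ∀ t ∈ Set.Icc 0 T, ∀ y ∈ Set.Icc 0 ε,
      fderiv ℝ a (t, X t + y) (1, 0) = fderiv ℝ w (t, X t + y) (0, 1) + h (t, X t + y) ∧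
      |a (t, X t + y) - U (t, X t + y)| ≤ η ∧ |w (t, X t + y) - U (t, X t + y) ^ 2 / 2| ≤ η ∧
      |h (t, X t + y) - G (t, X t + y)| ≤ η) :
    (∫ y in (0:ℝ)..ε, U (T, X T + y)) - (∫ y in (0:ℝ)..ε, U (0, X 0 + y))
      - (∫ t in (0:ℝ)..T, ∫ y in (0:ℝ)..ε, G (t, X t + y)) =
      (1 / 2) * ∫ t in (0:ℝ)..T, (U (t, X t + ε) - U (t, X t)) ^ 2 := by
  obtain ⟨M, hM⟩ := (isCompact_Icc (a := (0:ℝ)) (b := T)).exists_bound_of_continuousOn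
    (f := fun t => U (t, X t)) (by fun_prop)
  have hM0 : 0 ≤ M := (norm_nonneg _).trans (hM 0 ⟨le_rfl, hT⟩)
  have hIG : Continuous fun t => ∫ y in (0:ℝ)..ε, G (t, X t + y) :=
    intervalIntegral.continuous_parametric_intervalIntegral_of_continuous'
      (f := fun t y => G (t, X t + y)) (by simp only [Function.uncurry_def]; fun_prop) _ _
  set A := (∫ y in (0:ℝ)..ε, U (T, X T + y)) with hA
  set B := (∫ y in (0:ℝ)..ε, U (0, X 0 + y)) with hB
  set R := ∫ t in (0:ℝ)..T, (U (t, X t + ε) ^ 2 / 2 - U (t, X t) ^ 2 / 2 +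
      (∫ y in (0:ℝ)..ε, G (t, X t + y)) - U (t, X t) * (U (t, X t + ε) - U (t, X t))) with hR
  suffices hs : A - B - R = 0 by
    have : R = (∫ t in (0:ℝ)..T, ∫ y in (0:ℝ)..ε, G (t, X t + y)) +
        (1 / 2) * ∫ t in (0:ℝ)..T, (U (t, X t + ε) - U (t, X t)) ^ 2 := by
      rw [← intervalIntegral.integral_const_mul, ← intervalIntegral.integral_add
        (hIG.intervalIntegrable _ _) (Continuous.intervalIntegrable (by fun_prop) _ _), hR]
      congr 1; ext t; ring
    linarith
  have hbound : ∀ η : ℝ, 0 < η → |A - B - R| ≤ η * (2 * ε + (2 + ε + 2 * M) * T) := by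
    intro η hη
    obtain ⟨a, w, h, ha, hw, hh, H⟩ := happ η hη
    have hac := ha.continuous
    have hwc := hw.continuous
    have hIh : Continuous fun t => ∫ y in (0:ℝ)..ε, h (t, X t + y) :=
      intervalIntegral.continuous_parametric_intervalIntegral_of_continuous'
        (f := fun t y => h (t, X t + y)) (by simp only [Function.uncurry_def]; fun_prop) _ _
    have hcl := dfm_classical ha hw hh hU hX hT hε hd (fun t ht y hy => (H t ht y hy).1)
    have hAB : ∀ t ∈ Set.Icc 0 T,
        |(∫ y in (0:ℝ)..ε, a (t, X t + y)) - ∫ y in (0:ℝ)..ε, U (t, X t + y)| ≤ η * ε := by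
      intro t ht
      rw [← intervalIntegral.integral_sub (Continuous.intervalIntegrable (by fun_prop) _ _)
        (Continuous.intervalIntegrable (by fun_prop) _ _)]
      have := intervalIntegral.norm_integral_le_of_norm_le_const (a := 0) (b := ε) (C := η)
        (f := fun y => a (t, X t + y) - U (t, X t + y)) (fun y hy => by
          rw [Set.uIoc_of_le hε] at hy
          exact (H t ht y ⟨hy.1.le, hy.2⟩).2.1)
      simpa [abs_of_nonneg hε] using this
    have hGh : ∀ t ∈ Set.Icc 0 T,
        |(∫ y in (0:ℝ)..ε, h (t, X t + y)) - ∫ y in (0:ℝ)..ε, G (t, X t + y)| ≤ η * ε := by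
      intro t ht
      rw [← intervalIntegral.integral_sub (Continuous.intervalIntegrable (by fun_prop) _ _)
        (Continuous.intervalIntegrable (by fun_prop) _ _)]
      have := intervalIntegral.norm_integral_le_of_norm_le_const (a := 0) (b := ε) (C := η)
        (f := fun y => h (t, X t + y) - G (t, X t + y)) (fun y hy => by
          rw [Set.uIoc_of_le hε] at hy
          exact (H t ht y ⟨hy.1.le, hy.2⟩).2.2.2)
      simpa [abs_of_nonneg hε] using this
    set R' := ∫ t in (0:ℝ)..T, (w (t, X t + ε) - w (t, X t) + (∫ y in (0:ℝ)..ε, h (t, X t + y))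
        - U (t, X t) * (a (t, X t + ε) - a (t, X t))) with hR'
    have hRR : |R' - R| ≤ η * (2 + ε + 2 * M) * T := by
      rw [hR, hR', ← intervalIntegral.integral_sub (Continuous.intervalIntegrable (by fun_prop) _ _)
        (Continuous.intervalIntegrable (by fun_prop) _ _)]
      have := intervalIntegral.norm_integral_le_of_norm_le_const (a := 0) (b := T)
        (C := η * (2 + ε + 2 * M))
        (f := fun t => (w (t, X t + ε) - w (t, X t) + (∫ y in (0:ℝ)..ε, h (t, X t + y))
        - U (t, X t) * (a (t, X t + ε) - a (t, X t))) -
        (U (t, X t + ε) ^ 2 / 2 - U (t, X t) ^ 2 / 2 +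
      (∫ y in (0:ℝ)..ε, G (t, X t + y)) - U (t, X t) * (U (t, X t + ε) - U (t, X t))))
        (fun t ht => by
          rw [Set.uIoc_of_le hT] at ht
          have ht' : t ∈ Set.Icc 0 T := ⟨ht.1.le, ht.2⟩
          have H0 := H t ht' 0 ⟨le_rfl, hε⟩
          have H1 := H t ht' ε ⟨hε, le_rfl⟩
          rw [add_zero] at H0
          have H2 := hGh t ht'
          have H3 := hM t ht'
          rw [Real.norm_eq_abs] at H3 ⊢
          set I1 := ∫ y in (0:ℝ)..ε, h (t, X t + y)
          set I2 := ∫ y in (0:ℝ)..ε, G (t, X t + y)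
          obtain ⟨-, a0, w0, -⟩ := H0
          obtain ⟨-, a1, w1, -⟩ := H1
          have hp : |U (t, X t) * ((a (t, X t + ε) - U (t, X t + ε)) - (a (t, X t) - U (t, X t)))|
              ≤ M * (2 * η) := by
            rw [abs_mul]
            refine mul_le_mul H3 ?_ (abs_nonneg _) hM0
            rw [abs_le] at *
            constructor <;> linarith
          rw [abs_le] at *
          constructor <;> nlinarith)
      simpa [abs_of_nonneg hT] using this
    have hA' := hAB T ⟨hT, le_rfl⟩
    have hB' := hAB 0 ⟨le_rfl, hT⟩
    rw [abs_le] at *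
    constructor <;> nlinarith
  set L := 2 * ε + (2 + ε + 2 * M) * T
  have hL : 0 ≤ L := by positivity
  by_contra hne
  have hpos : 0 < |A - B - R| := abs_pos.2 hne
  have h1 := hbound (|A - B - R| / (2 * (L + 1))) (by positivity)
  have h2 : |A - B - R| / (2 * (L + 1)) * L < |A - B - R| := by
    rw [div_mul_eq_mul_div, div_lt_iff₀ (by positivity)]
    nlinarith
  linarith

theorem stmt_17 (Ω : Set (ℝ × ℝ)) (hΩ : IsOpen Ω)
    (u g : ℝ × ℝ → ℝ) (hu : ContinuousOn u Ω) (hg : ContinuousOn g Ω)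
    (C : ℝ) (hC : ∀ p ∈ Ω, |g p| ≤ C)
    (hdistr : ∀ φ : ℝ × ℝ → ℝ, ContDiff ℝ (⊤ : ℕ∞) φ → HasCompactSupport φ → tsupport φ ⊆ Ω →
      ∫ p in Ω, (-(u p) * fderiv ℝ φ p (1, 0) + (u p) ^ 2 / 2 * fderiv ℝ φ p (0, 1)) =
        ∫ p in Ω, g p * φ p)
    (T : ℝ) (hT : 0 ≤ T) (ξ : ℝ → ℝ)
    (hchar : ∀ t ∈ Set.Icc 0 T, HasDerivAt ξ (-(u (t, ξ t))) t)
    (ε₀ : ℝ) (hε₀ : 0 < ε₀)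
    (htube : ∀ t ∈ Set.Icc 0 T, ∀ x ∈ Set.Icc (ξ t) (ξ t + ε₀), (t, x) ∈ Ω) :
    -- the Dafermos identity on the right of the characteristic
    (∀ ε : ℝ, 0 < ε → ε ≤ ε₀ →
      (∫ x in (ξ T)..(ξ T + ε), u (T, x)) - (∫ x in (ξ 0)..(ξ 0 + ε), u (0, x))
        - ∫ t in (0:ℝ)..T, ∫ x in (ξ t)..(ξ t + ε), g (t, x)
      = (1 / 2) * ∫ t in (0:ℝ)..T, (u (t, ξ t + ε) - u (t, ξ t)) ^ 2) ∧
    -- the lower Lipschitz bound obtained from it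
    u (T, ξ T) - u (0, ξ 0) ≥ -(C * T) := by
  classical
  set X : ℝ → ℝ := fun t => ξ (Set.projIcc 0 T hT t) with hXdef
  have hXξ : ∀ t ∈ Set.Icc 0 T, X t = ξ t := by
    intro t ht
    simp only [hXdef, Set.projIcc_of_mem hT ht]
  have hξc : ContinuousOn ξ (Set.Icc 0 T) := fun t ht => (hchar t ht).continuousAt.continuousWithinAt
  have hX : Continuous X :=
    hξc.domRestrict.comp (continuous_projIcc (h := hT))
  set K : Set (ℝ × ℝ) := Set.image (fun q : ℝ × ℝ => (q.1, X q.1 + q.2))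
    (Set.Icc 0 T ×ˢ Set.Icc 0 ε₀) with hKdef
  have hK : IsCompact K := (isCompact_Icc.prod isCompact_Icc).image (by fun_prop)
  have hmem : ∀ t ∈ Set.Icc 0 T, ∀ y ∈ Set.Icc 0 ε₀, (t, X t + y) ∈ K := fun t ht y hy =>
    ⟨(t, y), ⟨ht, hy⟩, rfl⟩
  have hKΩ : K ⊆ Ω := by
    rintro _ ⟨⟨t, y⟩, ⟨ht, hy⟩, rfl⟩
    simp only at ht hy ⊢
    rw [hXξ t ht]
    exact htube t ht _ ⟨by linarith [hy.1], by linarith [hy.2]⟩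
  obtain ⟨δ₀, hδ₀, hth⟩ := hK.exists_cthickening_subset_open hΩ hKΩ
  obtain ⟨U, hU, hUu⟩ := dfm_ext (Metric.isClosed_cthickening (δ := δ₀) (E := K)) (hu.mono hth)
  obtain ⟨G, hG, hGg⟩ := dfm_ext (Metric.isClosed_cthickening (δ := δ₀) (E := K)) (hg.mono hth)
  have hUK : ∀ t ∈ Set.Icc 0 T, ∀ y ∈ Set.Icc 0 ε₀, U (t, X t + y) = u (t, ξ t + y) := by
    intro t ht y hy
    rw [hUu _ (Metric.self_subset_cthickening K (hmem t ht y hy)), hXξ t ht]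
  have hGK : ∀ t ∈ Set.Icc 0 T, ∀ y ∈ Set.Icc 0 ε₀, G (t, X t + y) = g (t, ξ t + y) := by
    intro t ht y hy
    rw [hGg _ (Metric.self_subset_cthickening K (hmem t ht y hy)), hXξ t ht]
  have hU0 : ∀ t ∈ Set.Icc 0 T, U (t, X t) = u (t, ξ t) := by
    intro t ht
    simpa using hUK t ht 0 ⟨le_rfl, hε₀.le⟩
  have hd : ∀ t ∈ Set.Ioo 0 T, HasDerivAt X (-(U (t, X t))) t := by
    intro t ht
    rw [hU0 t ⟨ht.1.le, ht.2.le⟩]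
    refine (hchar t ⟨ht.1.le, ht.2.le⟩).congr_of_eventuallyEq ?_
    filter_upwards [Icc_mem_nhds ht.1 ht.2] with s hs using hXξ s hs
  have h0T : (0:ℝ) ∈ Set.Icc 0 T := ⟨le_rfl, hT⟩
  have hTT : T ∈ Set.Icc 0 T := ⟨hT, le_rfl⟩
  have hcore : ∀ ε : ℝ, 0 < ε → ε ≤ ε₀ → _ := fun ε h1 h2 =>
    dfm_core (ε := ε) hU hG hX hT h1.le hd (fun η hη => by
      obtain ⟨a, w, h, ha, hw, hh, H⟩ := dfm_mollify hdistr hK hδ₀ hth hU hG hUu hGg hη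
      exact ⟨a, w, h, ha, hw, hh, fun t ht y hy => H _ (hmem t ht y ⟨hy.1, hy.2.trans h2⟩)⟩)
  refine ⟨fun ε h1 h2 => ?_, ?_⟩
  · have hI : ∀ t ∈ Set.Icc 0 T,
        ∫ x in (ξ t)..(ξ t + ε), u (t, x) = ∫ y in (0:ℝ)..ε, U (t, X t + y) := by
      intro t ht
      have := intervalIntegral.integral_comp_add_left (a := 0) (b := ε) (fun x => u (t, x)) (ξ t)
      rw [add_zero] at this
      rw [← this]
      apply intervalIntegral.integral_congr
      intro y hy
      rw [Set.uIcc_of_le h1.le] at hy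
      exact (hUK t ht y ⟨hy.1, hy.2.trans h2⟩).symm
    have hJ : ∀ t ∈ Set.Icc 0 T,
        ∫ x in (ξ t)..(ξ t + ε), g (t, x) = ∫ y in (0:ℝ)..ε, G (t, X t + y) := by
      intro t ht
      have := intervalIntegral.integral_comp_add_left (a := 0) (b := ε) (fun x => g (t, x)) (ξ t)
      rw [add_zero] at this
      rw [← this]
      apply intervalIntegral.integral_congr
      intro y hy
      rw [Set.uIcc_of_le h1.le] at hy
      exact (hGK t ht y ⟨hy.1, hy.2.trans h2⟩).symm
    have e1 : ∫ t in (0:ℝ)..T, ∫ x in (ξ t)..(ξ t + ε), g (t, x) =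
        ∫ t in (0:ℝ)..T, ∫ y in (0:ℝ)..ε, G (t, X t + y) := by
      apply intervalIntegral.integral_congr
      intro t ht
      rw [Set.uIcc_of_le hT] at ht
      exact hJ t ht
    have e2 : ∫ t in (0:ℝ)..T, (u (t, ξ t + ε) - u (t, ξ t)) ^ 2 =
        ∫ t in (0:ℝ)..T, (U (t, X t + ε) - U (t, X t)) ^ 2 := by
      apply intervalIntegral.integral_congr
      intro t ht
      rw [Set.uIcc_of_le hT] at ht
      simp only
      rw [hUK t ht ε ⟨h1.le, h2⟩, hU0 t ht]
    rw [hI T hTT, hI 0 h0T, e1, e2]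
    exact hcore ε h1 h2
  · rw [← hU0 T hTT, ← hU0 0 h0T]
    by_contra hlt
    rw [ge_iff_le, not_le] at hlt
    let f : ℝ → ℝ := fun y => U (T, X T + y) - U (0, X 0 + y)
    have hf : Continuous f := by fun_prop
    have hf0 : f 0 < -(C * T) := by simpa [f] using hlt
    obtain ⟨c, hc1, hc2⟩ := exists_between hf0
    have hev : ∀ᶠ y in nhds 0, f y < c := hf.continuousAt.eventually_lt_const hc1
    obtain ⟨r, hr, hball⟩ := Metric.eventually_nhds_iff.1 hev
    set ε := min ε₀ (r / 2) with hεdef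
    have h1 : 0 < ε := by positivity
    have h2 : ε ≤ ε₀ := min_le_left _ _
    have h3 : ε < r := lt_of_le_of_lt (min_le_right _ _) (by linarith)
    have hid := hcore ε h1 h2
    have hI1 : ∫ y in (0:ℝ)..ε, f y ≤ c * ε := by
      have := intervalIntegral.integral_mono_on (μ := volume) (a := 0) (b := ε) (f := f)
        (g := fun _ => c) h1.le (hf.intervalIntegrable _ _) (by simp) (fun y hy => by
          refine (hball ?_).le
          rw [Real.dist_eq, sub_zero, abs_of_nonneg hy.1]
          exact lt_of_le_of_lt hy.2 h3)
      simpa [mul_comm] using this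
    have hI2 : ∫ y in (0:ℝ)..ε, f y = (∫ y in (0:ℝ)..ε, U (T, X T + y)) -
        ∫ y in (0:ℝ)..ε, U (0, X 0 + y) :=
      intervalIntegral.integral_sub (Continuous.intervalIntegrable (by fun_prop) _ _)
        (Continuous.intervalIntegrable (by fun_prop) _ _)
    have hGb : |∫ t in (0:ℝ)..T, ∫ y in (0:ℝ)..ε, G (t, X t + y)| ≤ C * ε * T := by
      have := intervalIntegral.norm_integral_le_of_norm_le_const (a := 0) (b := T) (C := C * ε)
        (f := fun t => ∫ y in (0:ℝ)..ε, G (t, X t + y)) (fun t ht => by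
          rw [Set.uIoc_of_le hT] at ht
          have ht' : t ∈ Set.Icc 0 T := ⟨ht.1.le, ht.2⟩
          have := intervalIntegral.norm_integral_le_of_norm_le_const (a := 0) (b := ε) (C := C)
            (f := fun y => G (t, X t + y)) (fun y hy => by
              rw [Set.uIoc_of_le h1.le] at hy
              have hm := hmem t ht' y ⟨hy.1.le, hy.2.trans h2⟩
              rw [hGg _ (Metric.self_subset_cthickening K hm)]
              exact hC _ (hKΩ hm))
          simpa [abs_of_pos h1] using this)
      simpa [abs_of_nonneg hT] using this
    have hpos : 0 ≤ ∫ t in (0:ℝ)..T, (U (t, X t + ε) - U (t, X t)) ^ 2 :=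
      intervalIntegral.integral_nonneg hT (fun t _ => sq_nonneg _)
    have hlast : c * ε < -(C * T) * ε := mul_lt_mul_of_pos_right hc2 h1
    have := neg_le_of_abs_le hGb
    nlinarith
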